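/- arXiv:2510.27216 — 2 statements merged into one kernel-verified Lean document; each statement's English description precedes it below -/
import Mathlib

section
/- If the continuous flow φ_t on the compact metric space M has no fixed points, then every continuous function f : M → ℝ has bounded variation; that is, lim_{ε→0} limsup_{t→∞} γ_t(f,ε)/t = 0, where γ_t(f,ε) = sup{ |∫₀ᵗ (f(φ_s(y)) − f(φ_s(z))) ds| : y,z ∈ B̃(x,t,ε) for some x ∈ M }. -/
open Filter Set MeasureTheory Topology

noncomputable section

variable {M : Type*} [MetricSpace M] [MeasurableSpace M]

/-- A reparametrization function on the interval `[0, t]`: a continuous strictly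
increasing function fixing `0`. -/
def IsRep (t : ℝ) (α : ℝ → ℝ) : Prop :=
  ContinuousOn α (Icc 0 t) ∧ StrictMonoOn α (Icc 0 t) ∧ α 0 = 0

/-- The Bowen ball `B(x,t,ε)` of a flow. -/
def BowenBall (φ : ℝ → M → M) (x : M) (t ε : ℝ) : Set M :=
  {y | ∀ s ∈ Icc (0 : ℝ) t, dist (φ s x) (φ s y) < ε}

/-- The reparametrization Bowen ball `B̃(x,t,ε)` of a flow. -/
def RepBowenBall (φ : ℝ → M → M) (x : M) (t ε : ℝ) : Set M :=
  {y | ∃ α : ℝ → ℝ, IsRep t α ∧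
    ∀ s ∈ Icc (0 : ℝ) t, dist (φ (α s) x) (φ s y) < ε}

/-- The weighted sum `∑_{x ∈ F} exp (∫₀ᵗ f(φ_s(x)) ds)`. -/
def fweight (φ : ℝ → M → M) (f : M → ℝ) (t : ℝ) (F : Finset M) : ℝ :=
  ∑ x ∈ F, Real.exp (∫ s in (0 : ℝ)..t, f (φ s x))

/-- The quantity `N^μ(δ,t,ε,f)` (resp. `Ñ^μ(δ,t,ε,f)`), where the (plain or
reparametrization) Bowen ball is passed as the argument `Bb`. -/
def NmuFlow (φ : ℝ → M → M) (μ : Measure M) (Bb : M → ℝ → ℝ → Set M)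
    (δ t ε : ℝ) (f : M → ℝ) : ℝ :=
  sInf {r | ∃ F : Finset M,
    ENNReal.ofReal (1 - δ) < μ (⋃ x ∈ F, Bb x t ε) ∧ r = fweight φ f t F}

/-- `limsup_{t → ∞} (1/t) log (g t)`. -/
def upRate (g : ℝ → ℝ) : ℝ := limsup (fun t => Real.log (g t) / t) atTop

/-- `liminf_{t → ∞} (1/t) log (g t)`. -/
def loRate (g : ℝ → ℝ) : ℝ := liminf (fun t => Real.log (g t) / t) atTop

/-- The limit as `ε → 0⁺`. -/
def zlim (h : ℝ → ℝ) : ℝ := limUnder (𝓝[>] (0 : ℝ)) h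

/-- The variation `γ_t(f,ε)` of Birkhoff integrals over points of a common
reparametrization Bowen ball. -/
def gammaT (φ : ℝ → M → M) (f : M → ℝ) (t ε : ℝ) : ℝ :=
  sSup {r | ∃ x y z : M, y ∈ RepBowenBall φ x t ε ∧ z ∈ RepBowenBall φ x t ε ∧
    r = |∫ s in (0 : ℝ)..t, (f (φ s y) - f (φ s z))|}

/-- The contribution `-μ(s) log μ(s)` of a cell to the entropy of a partition. -/
def entTerm (μ : Measure M) (s : Set M) : ℝ := -((μ s).toReal * Real.log (μ s).toReal)

/-- The dynamical entropy `h_μ(T, ξ)` of a finite measurable partition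
`ξ = {C i}` with respect to `T`:
`lim_{m→∞} (1/m) H_μ(ξ ∨ T⁻¹ξ ∨ ⋯ ∨ T^{-(m-1)}ξ)`. -/
def dynEnt (μ : Measure M) (T : M → M) {N : ℕ} (C : Fin N → Set M) : ℝ :=
  limUnder atTop fun m : ℕ =>
    (∑ a : Fin m → Fin N, entTerm μ (⋂ k : Fin m, T^[(k : ℕ)] ⁻¹' C (a k))) / (m : ℝ)

/-- `C` is a finite measurable partition of `M`. -/
def IsFinPart {N : ℕ} (C : Fin N → Set M) : Prop :=
  (∀ i, MeasurableSet (C i)) ∧ Pairwise (Function.onFun Disjoint C) ∧ ⋃ i, C i = univ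

/-- The metric (Kolmogorov–Sinai) entropy `h_μ(T)`. -/
def mEntropy (μ : Measure M) (T : M → M) : ℝ :=
  sSup {h | ∃ (N : ℕ) (C : Fin N → Set M), IsFinPart C ∧ h = dynEnt μ T C}

end

/-- Integer multiples of a period are periods. -/
lemma flow_int_mul_period {M : Type*} {φ : ℝ → M → M} (hφ0 : ∀ x, φ 0 x = x)
    (hφadd : ∀ t s x, φ (t + s) x = φ t (φ s x)) {τ : ℝ} {x : M} (h : φ τ x = x) (m : ℤ) :
    φ (m * τ) x = x := by
  have hneg : φ (-τ) x = x := by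
    conv_lhs => rw [← h]
    rw [← hφadd, neg_add_cancel, hφ0]
  induction m using Int.induction_on with
  | zero => simp [hφ0]
  | succ n ih =>
    rw [show (((n : ℤ) + 1 : ℤ) : ℝ) * τ = ((n : ℤ) : ℝ) * τ + τ by push_cast; ring,
      hφadd, h, ih]
  | pred n ih =>
    rw [show ((-(n : ℤ) - 1 : ℤ) : ℝ) * τ = ((-(n : ℤ) : ℤ) : ℝ) * τ + -τ by push_cast; ring,
      hφadd, hneg, ih]

section FixedPointFreeFlow

variable {M : Type*} [MetricSpace M] [CompactSpace M] {φ : ℝ → M → M}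

/-- The periods of a flow without fixed points on a compact space are bounded below. -/
lemma exists_period_lower_bound (hφcont : Continuous fun p : ℝ × M => φ p.1 p.2)
    (hφ0 : ∀ x, φ 0 x = x) (hφadd : ∀ t s x, φ (t + s) x = φ t (φ s x))
    (hfix : ∀ x : M, ∃ t : ℝ, φ t x ≠ x) :
    ∃ T > 0, ∀ τ, 0 < τ → τ ≤ T → ∀ x, φ τ x ≠ x := by
  by_contra! H
  choose τ hτ0 hτ x hx using fun n : ℕ => H (1 / ((n : ℝ) + 1)) (by positivity)
  obtain ⟨a, -, u, hu, hlim⟩ := isCompact_univ.tendsto_subseq (fun n => mem_univ (x n))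
  obtain ⟨t, ht⟩ := hfix a
  refine ht ?_
  have hτlim : Tendsto (fun n => τ (u n)) atTop (𝓝 0) :=
    (squeeze_zero (fun n => (hτ0 n).le) hτ tendsto_one_div_add_atTop_nhds_zero_nat).comp
      hu.tendsto_atTop
  have hfloor : Tendsto (fun n => (⌊t / τ (u n)⌋ : ℝ) * τ (u n)) atTop (𝓝 t) := by
    refine tendsto_of_tendsto_of_tendsto_of_le_of_le
      (by simpa using tendsto_const_nhds.sub hτlim) tendsto_const_nhds (fun n => ?_) fun n => ?_
    · have h := Int.lt_floor_add_one (t / τ (u n))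
      rw [div_lt_iff₀ (hτ0 _)] at h
      simp only
      linarith
    · have h := Int.floor_le (t / τ (u n))
      rwa [le_div_iff₀ (hτ0 _)] at h
  have h1 := (hφcont.tendsto (t, a)).comp (hfloor.prodMk_nhds hlim)
  refine tendsto_nhds_unique h1 (hlim.congr fun n => ?_)
  exact (flow_int_mul_period hφ0 hφadd (hx (u n)) _).symm

/-- A map without fixed points on a compact space displaces points uniformly. -/
lemma exists_le_dist_of_forall_ne {g : M → M} (hg : Continuous g) (h : ∀ x, g x ≠ x) :
    ∃ c > 0, ∀ x, c ≤ dist (g x) x := by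
  rcases isEmpty_or_nonempty M with hM | hM
  · exact ⟨1, one_pos, fun x => hM.elim x⟩
  · obtain ⟨a, -, ha⟩ := isCompact_univ.exists_isMinOn univ_nonempty
      (hg.dist continuous_id).continuousOn
    exact ⟨dist (g a) a, dist_pos.2 (h a), fun x => ha (mem_univ x)⟩

/-- Nearby points stay close during a unit of time. -/
lemma exists_dist_flow_lt (hφcont : Continuous fun p : ℝ × M => φ p.1 p.2) {δ : ℝ}
    (hδ : 0 < δ) :
    ∃ ε > 0, ∀ x y, dist x y < ε → ∀ s ∈ Icc (0 : ℝ) 1, dist (φ s x) (φ s y) < δ := by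
  have hu := ((isCompact_Icc (a := (0 : ℝ)) (b := 1)).prod
    (isCompact_univ (X := M))).uniformContinuousOn_of_continuous hφcont.continuousOn
  obtain ⟨ε, hε, H⟩ := Metric.uniformContinuousOn_iff.1 hu δ hδ
  refine ⟨ε, hε, fun x y hxy s hs => H (s, x) ⟨hs, mem_univ _⟩ (s, y) ⟨hs, mem_univ _⟩ ?_⟩
  simpa [Prod.dist_eq, hε] using hxy

/-- Reparametrized shadowing within a small distance barely changes the time. -/
lemma exists_abs_reparam_sub_le (hφcont : Continuous fun p : ℝ × M => φ p.1 p.2)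
    (hφ0 : ∀ x, φ 0 x = x) (hφadd : ∀ t s x, φ (t + s) x = φ t (φ s x))
    (hfix : ∀ x : M, ∃ t : ℝ, φ t x ≠ x) {η : ℝ} (hη : 0 < η) :
    ∃ ε > 0, ∀ (x y : M) (h : ℝ) (α : ℝ → ℝ), 0 ≤ h → h ≤ 1 → ContinuousOn α (Icc 0 h) →
      α 0 = 0 → (∀ s ∈ Icc 0 h, dist (φ (α s) x) (φ s y) < ε) → |α h - h| ≤ η := by
  obtain ⟨T, hT, hper⟩ := exists_period_lower_bound hφcont hφ0 hφadd hfix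
  set θ := min η T with hθ
  have hθ0 : 0 < θ := lt_min hη hT
  obtain ⟨c, hc, hdisp⟩ := exists_le_dist_of_forall_ne
    (hφcont.comp (continuous_const.prodMk continuous_id)) (hper θ hθ0 (min_le_right _ _))
  obtain ⟨ε, hε, hunif⟩ := exists_dist_flow_lt hφcont (half_pos hc)
  refine ⟨min ε (c / 2), lt_min hε (half_pos hc), fun x y h α h0 h1 hα hα0 hd => ?_⟩
  have hxy : dist x y < ε := by
    have := hd 0 ⟨le_rfl, h0⟩
    rw [hα0, hφ0, hφ0] at this
    exact this.trans_le (min_le_left _ _)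
  have hclose : ∀ s ∈ Icc 0 h, dist (φ (α s) x) (φ s x) < c := fun s hs => by
    have h2 := (hd s hs).trans_le (min_le_right _ _)
    have h3 := hunif x y hxy s ⟨hs.1, hs.2.trans h1⟩
    have h4 := dist_triangle_right (φ (α s) x) (φ s x) (φ s y)
    linarith
  have hcont : ContinuousOn (fun s => α s - s) (Icc 0 h) := hα.sub continuousOn_id
  refine le_trans ?_ (min_le_left η T)
  rw [← hθ]
  by_contra! hlt
  rcases lt_abs.1 hlt with hlt | hlt
  · obtain ⟨s, hs, hsθ⟩ := intermediate_value_Icc h0 hcont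
      (show θ ∈ Icc (α 0 - 0) (α h - h) from ⟨by rw [hα0]; linarith, hlt.le⟩)
    have h5 := hdisp (φ s x)
    have h6 := hclose s hs
    rw [show α s = θ + s by simp only at hsθ; linarith, hφadd] at h6
    exact absurd h6 (not_lt.2 h5)
  · obtain ⟨s, hs, hsθ⟩ := intermediate_value_Icc' h0 hcont
      (show -θ ∈ Icc (α h - h) (α 0 - 0) from ⟨by linarith, by rw [hα0]; linarith⟩)
    have h5 := hdisp (φ (α s) x)
    have h6 := hclose s hs
    nth_rewrite 2 [show s = θ + α s by simp only at hsθ; linarith] at h6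
    rw [hφadd, dist_comm] at h6
    exact absurd h6 (not_lt.2 h5)

/-- Birkhoff integrals along orbits that shadow each other up to reparametrization differ by a
small amount per unit of time. -/
lemma exists_abs_integral_sub_le (hφcont : Continuous fun p : ℝ × M => φ p.1 p.2)
    (hφ0 : ∀ x, φ 0 x = x) (hφadd : ∀ t s x, φ (t + s) x = φ t (φ s x))
    (hfix : ∀ x : M, ∃ t : ℝ, φ t x ≠ x) {f : M → ℝ} (hf : Continuous f) {κ : ℝ}
    (hκ : 0 < κ) :
    ∃ ε > 0, ∀ (x y : M) (t : ℝ) (α : ℝ → ℝ), 1 ≤ t → ContinuousOn α (Icc 0 t) → α 0 = 0 →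
      (∀ s ∈ Icc 0 t, dist (φ (α s) x) (φ s y) < ε) →
      |(∫ s in (0 : ℝ)..t, f (φ s y)) - ∫ s in (0 : ℝ)..t, f (φ s x)| ≤ κ * t := by
  obtain ⟨C, hC⟩ := isCompact_univ.exists_bound_of_continuousOn hf.continuousOn (s := univ)
  have hC1 : ∀ x, ‖f x‖ ≤ max C 1 := fun x => (hC x (mem_univ x)).trans (le_max_left _ _)
  generalize max C 1 = B, le_max_right C 1 = hB at hC1
  have hB0 : 0 < B := one_pos.trans_le hB
  obtain ⟨δ, hδ, hfδ⟩ := Metric.uniformContinuous_iff.1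
    (CompactSpace.uniformContinuous_of_continuous hf) (κ / 4) (by positivity)
  obtain ⟨ε₁, hε₁, hunif⟩ := exists_dist_flow_lt hφcont hδ
  obtain ⟨ε₂, hε₂, hdrift⟩ := exists_abs_reparam_sub_le hφcont hφ0 hφadd hfix
    (show 0 < κ / (8 * B) by positivity)
  set η := κ / (8 * B) with hη
  have hBη : B * η = κ / 8 := by rw [hη]; field_simp
  refine ⟨min ε₁ ε₂, lt_min hε₁ hε₂, fun x y t α ht hα hα0 hd => ?_⟩
  have hfc : ∀ z, Continuous fun s => f (φ s z) := fun z =>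
    hf.comp (hφcont.comp (continuous_id.prodMk continuous_const))
  have hint : ∀ z a b, IntervalIntegrable (fun s => f (φ s z)) volume a b := fun z a b =>
    (hfc z).intervalIntegrable a b
  have hbd : ∀ z a b, |∫ s in a..b, f (φ s z)| ≤ B * |b - a| := fun z a b =>
    intervalIntegral.norm_integral_le_of_norm_le_const fun s _ => hC1 _
  set N := ⌈t⌉₊
  have hNt : t ≤ N := Nat.le_ceil t
  have hNt' : (N : ℝ) < t + 1 := Nat.ceil_lt_add_one (by linarith)
  have hN0 : (0 : ℝ) < N := by linarith
  set h := t / N with hh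
  have hh0 : 0 ≤ h := by positivity
  have hh1 : h ≤ 1 := (div_le_one hN0).2 hNt
  have hNh : N * h = t := by rw [hh]; field_simp
  have key : ∀ k : ℕ, k ≤ N → |α (k * h) - k * h| ≤ k * η ∧
      |(∫ s in (0 : ℝ)..k * h, f (φ s y)) - ∫ s in (0 : ℝ)..α (k * h), f (φ s x)|
        ≤ k * (κ / 4 + B * η) := by
    intro k
    induction k with
    | zero => simp [hα0]
    | succ k ih =>
      intro hk
      obtain ⟨ih1, ih2⟩ := ih (by omega)
      have hk' : (k : ℝ) + 1 ≤ N := by exact_mod_cast hk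
      have hkt : (k + 1) * h ≤ t := by rw [← hNh]; gcongr
      have hkh0 : 0 ≤ k * h := by positivity
      push_cast
      have hmem : ∀ s ∈ Icc 0 h, k * h + s ∈ Icc 0 t := fun s hs =>
        ⟨by linarith [hs.1], by linarith [hs.2]⟩
      have hstep := hdrift (φ (α (k * h)) x) (φ (k * h) y) h (fun s => α (k * h + s) - α (k * h))
        hh0 hh1 ((hα.comp (by fun_prop) hmem).sub continuousOn_const) (by simp) fun s hs => by
          rw [← hφadd, ← hφadd, sub_add_cancel, add_comm s]
          exact (hd _ (hmem s hs)).trans_le (min_le_right _ _)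
      rw [show k * h + h = (k + 1) * h by ring] at hstep
      set a := α (k * h)
      set b := α ((k + 1) * h)
      have hnear : dist (φ a x) (φ (k * h) y) < ε₁ :=
        (hd _ ⟨hkh0, by linarith⟩).trans_le (min_le_left _ _)
      constructor
      · have e : b - (k + 1) * h = (a - k * h) + (b - a - h) := by ring
        rw [e]
        linarith [abs_add_le (a - k * h) (b - a - h)]
      · have h1 : |∫ s in (0 : ℝ)..h, (f (φ (s + k * h) y) - f (φ (s + a) x))| ≤ κ / 4 := by
          have h2 := intervalIntegral.norm_integral_le_of_norm_le_const (a := (0 : ℝ)) (b := h)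
            (f := fun s => f (φ (s + k * h) y) - f (φ (s + a) x)) (C := κ / 4) fun s hs => by
              rw [uIoc_of_le hh0] at hs
              rw [← dist_eq_norm, dist_comm, hφadd, hφadd]
              exact (hfδ (hunif _ _ hnear s ⟨hs.1.le, hs.2.trans hh1⟩)).le
          rw [sub_zero, abs_of_nonneg hh0] at h2
          refine h2.trans ?_
          nlinarith
        have hshift : ∀ z c, IntervalIntegrable (fun s => f (φ (s + c) z)) volume 0 h :=
          fun z c => ((hfc z).comp (continuous_add_const c)).intervalIntegrable _ _
        rw [intervalIntegral.integral_sub (hshift y _) (hshift x _),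
          intervalIntegral.integral_comp_add_right (fun s => f (φ s y)),
          intervalIntegral.integral_comp_add_right (fun s => f (φ s x)),
          zero_add, zero_add] at h1
        have h3 := hbd x (h + a) b
        have h4 : B * |b - (h + a)| ≤ B * η := by
          rw [show b - (h + a) = b - a - h by ring]
          gcongr
        have e1 := intervalIntegral.integral_add_adjacent_intervals
          (hint y 0 (k * h)) (hint y (k * h) (h + k * h))
        have e2 := intervalIntegral.integral_add_adjacent_intervals
          (hint x 0 a) (hint x a (h + a))
        have e3 := intervalIntegral.integral_add_adjacent_intervals
          (hint x 0 (h + a)) (hint x (h + a) b)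
        rw [show (k + 1) * h = h + k * h by ring]
        rw [abs_le] at *
        constructor <;> linarith
  obtain ⟨k1, k2⟩ := key N le_rfl
  rw [hNh] at k1 k2
  have h5 := hbd x t (α t)
  have h6 : B * |α t - t| ≤ B * (N * η) := by gcongr
  have h7 := intervalIntegral.integral_add_adjacent_intervals (hint x 0 t) (hint x t (α t))
  have h8 : B * (N * η) = N * (κ / 8) := by rw [← hBη]; ring
  rw [hBη] at k2
  have h9 : N * κ ≤ 2 * t * κ := by
    gcongr
    linarith
  rw [abs_le] at k2 h5 ⊢
  constructor <;> linarith

/-- The variation of Birkhoff integrals over reparametrization Bowen balls of small radius is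
small per unit of time. -/
lemma exists_gammaT_le [MeasurableSpace M]
    (hφcont : Continuous fun p : ℝ × M => φ p.1 p.2)
    (hφ0 : ∀ x, φ 0 x = x) (hφadd : ∀ t s x, φ (t + s) x = φ t (φ s x))
    (hfix : ∀ x : M, ∃ t : ℝ, φ t x ≠ x) {f : M → ℝ} (hf : Continuous f) {κ : ℝ}
    (hκ : 0 < κ) :
    ∃ ε₀ > 0, ∀ ε ≤ ε₀, ∀ t ≥ 1, gammaT φ f t ε ≤ κ * t := by
  obtain ⟨ε₀, hε₀, H⟩ :=
    exists_abs_integral_sub_le hφcont hφ0 hφadd hfix hf (half_pos hκ)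
  refine ⟨ε₀, hε₀, fun ε hε t ht => Real.sSup_le ?_ (by positivity)⟩
  rintro r ⟨x, y, z, ⟨α, ⟨hα, -, hα0⟩, hy⟩, ⟨β, ⟨hβ, -, hβ0⟩, hz⟩, rfl⟩
  have h1 := H x y t α ht hα hα0 fun s hs => (hy s hs).trans_le hε
  have h2 := H x z t β ht hβ hβ0 fun s hs => (hz s hs).trans_le hε
  have hint : ∀ z, IntervalIntegrable (fun s => f (φ s z)) volume 0 t := fun z =>
    (hf.comp (hφcont.comp (continuous_id.prodMk continuous_const))).intervalIntegrable _ _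
  rw [intervalIntegral.integral_sub (hint y) (hint z)]
  rw [abs_le] at *
  constructor <;> linarith

end FixedPointFreeFlow

lemma gammaT_nonneg {M : Type*} [MetricSpace M] [MeasurableSpace M] (φ : ℝ → M → M)
    (f : M → ℝ) (t ε : ℝ) : 0 ≤ gammaT φ f t ε := by
  refine Real.sSup_nonneg ?_
  rintro r ⟨x, y, z, -, -, rfl⟩
  exact abs_nonneg _

theorem bounded_variation_fixed_point_free
    {M : Type*} [MetricSpace M] [CompactSpace M]
    [MeasurableSpace M] [BorelSpace M]
    (φ : ℝ → M → M)
    (hφcont : Continuous fun p : ℝ × M => φ p.1 p.2)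
    (hφ0 : ∀ x, φ 0 x = x)
    (hφadd : ∀ t s x, φ (t + s) x = φ t (φ s x))
    (hfix : ∀ x : M, ∃ t : ℝ, φ t x ≠ x)
    (f : M → ℝ) (hf : Continuous f) :
    Tendsto (fun ε => limsup (fun t => gammaT φ f t ε / t) atTop)
      (𝓝[>] (0 : ℝ)) (𝓝 0) := by
  rw [Metric.tendsto_nhds]
  intro κ hκ
  obtain ⟨ε₀, hε₀, H⟩ := exists_gammaT_le hφcont hφ0 hφadd hfix hf (half_pos hκ)
  filter_upwards [Ioo_mem_nhdsGT hε₀] with ε hε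
  have hle : ∀ᶠ t in atTop, gammaT φ f t ε / t ≤ κ / 2 := by
    filter_upwards [eventually_ge_atTop (1 : ℝ)] with t ht
    rw [div_le_iff₀ (by linarith)]
    exact H ε hε.2.le t ht
  have hge : ∀ᶠ t in atTop, 0 ≤ gammaT φ f t ε / t := by
    filter_upwards [eventually_ge_atTop (1 : ℝ)] with t ht
    exact div_nonneg (gammaT_nonneg φ f t ε) (by linarith)
  have h1 := limsup_le_of_le (isCoboundedUnder_le_of_eventually_le atTop hge) hle
  have h2 := le_limsup_of_frequently_le hge.frequently (isBoundedUnder_of_eventually_le hle)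
  rw [Real.dist_eq, sub_zero, abs_of_nonneg h2]
  linarith
end

section
/- Let φ_t be a continuous flow without fixed points on the compact metric space M. For every Borel probability measure μ on M, every δ ∈ (0,1), and every continuous f : M → ℝ: lim_{ε→0} limsup_{t→∞} (1/t) log N^μ(δ,t,ε,f) = lim_{ε→0} limsup_{t→∞} (1/t) log Ñ^μ(δ,t,ε,f), and lim_{ε→0} liminf_{t→∞} (1/t) log N^μ(δ,t,ε,f) = lim_{ε→0} liminf_{t→∞} (1/t) log Ñ^μ(δ,t,ε,f). -/
open Filter Set MeasureTheory Topology

/-- `φ` is a continuous flow on `M`. -/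
structure IsContFlow {M : Type*} [TopologicalSpace M] (φ : ℝ → M → M) : Prop where
  cont : Continuous fun p : ℝ × M => φ p.1 p.2
  zero : ∀ x, φ 0 x = x
  add : ∀ t s x, φ (t + s) x = φ t (φ s x)

namespace IsContFlow

section Topology

variable {M : Type*} [TopologicalSpace M] {φ : ℝ → M → M}

lemma continuous_orbit (h : IsContFlow φ) (x : M) : Continuous fun s => φ s x :=
  h.cont.comp (continuous_id.prodMk continuous_const)

lemma continuous_time (h : IsContFlow φ) (s : ℝ) : Continuous (φ s) :=
  h.cont.comp (continuous_const.prodMk continuous_id)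

lemma intervalIntegrable (h : IsContFlow φ) {f : M → ℝ} (hf : Continuous f) (x : M) (a b : ℝ) :
    IntervalIntegrable (fun s => f (φ s x)) volume a b :=
  (hf.comp (h.continuous_orbit x)).intervalIntegrable a b

lemma integral_shift (h : IsContFlow φ) (f : M → ℝ) (x : M) (a b : ℝ) :
    ∫ s in (0 : ℝ)..b, f (φ s (φ a x)) = ∫ s in a..(a + b), f (φ s x) := by
  have := intervalIntegral.integral_comp_add_right (a := 0) (b := b) (fun s => f (φ s x)) a
  simp only [h.add, zero_add] at this
  rw [this, add_comm a b]

lemma iterate_period (h : IsContFlow φ) {ρ : ℝ} {x : M} (hx : φ ρ x = x) (m : ℤ) :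
    φ (m * ρ) x = x := by
  induction m using Int.induction_on with
  | zero => simp [h.zero]
  | succ k ih =>
    rw [show ((k + 1 : ℤ) : ℝ) * ρ = (k : ℤ) * ρ + ρ by push_cast; ring, h.add, hx, ih]
  | pred k ih =>
    have : φ (((-k - 1 : ℤ) : ℝ) * ρ + ρ) x = x := by
      convert ih using 2; push_cast; ring
    rwa [h.add, hx] at this

end Topology

variable {M : Type*} [MetricSpace M] [CompactSpace M] {φ : ℝ → M → M}

lemma uniform_modulus (h : IsContFlow φ) (L : ℝ) {ε : ℝ} (hε : 0 < ε) :
    ∃ σ > 0, ∀ s ∈ Icc (-L) L, ∀ s' ∈ Icc (-L) L, ∀ u v : M, |s - s'| < σ → dist u v < σ →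
      dist (φ s u) (φ s' v) < ε := by
  have hu := (isCompact_Icc (a := -L) (b := L)).prod (isCompact_univ (X := M))
    |>.uniformContinuousOn_of_continuous h.cont.continuousOn
  obtain ⟨σ, hσ, H⟩ := Metric.uniformContinuousOn_iff.1 hu ε hε
  refine ⟨σ, hσ, fun s hs s' hs' u v h1 h2 =>
    H (s, u) ⟨hs, mem_univ _⟩ (s', v) ⟨hs', mem_univ _⟩ ?_⟩
  rw [Prod.dist_eq]
  exact max_lt h1 h2

lemma space_modulus (h : IsContFlow φ) (L : ℝ) {ε : ℝ} (hε : 0 < ε) :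
    ∃ σ > 0, ∀ u v : M, dist u v < σ → ∀ s ∈ Icc (0 : ℝ) L, dist (φ s u) (φ s v) < ε := by
  obtain ⟨σ, hσ, H⟩ := h.uniform_modulus L hε
  refine ⟨σ, hσ, fun u v huv s hs => ?_⟩
  have hs' : s ∈ Icc (-L) L := ⟨by linarith [hs.1, hs.2], hs.2⟩
  exact H s hs' s hs' u v (by simpa) huv

lemma time_modulus (h : IsContFlow φ) {ε : ℝ} (hε : 0 < ε) :
    ∃ ρ > 0, ∀ r : ℝ, |r| < ρ → ∀ u : M, dist (φ r u) u < ε := by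
  obtain ⟨σ, hσ, H⟩ := h.uniform_modulus 1 hε
  refine ⟨min σ 1, by positivity, fun r hr u => ?_⟩
  have h1 := abs_lt.1 (hr.trans_le (min_le_right _ _))
  simpa [h.zero] using H r ⟨h1.1.le, h1.2.le⟩ 0 (by simp) u u
    (by simpa using hr.trans_le (min_le_left _ _)) (by simpa)

/-- A flow without fixed points on a compact space has no arbitrarily short periods. -/
lemma exists_no_short_period (h : IsContFlow φ) (hfix : ∀ x : M, ∃ t : ℝ, φ t x ≠ x) :
    ∃ T > 0, ∀ ρ ∈ Ioo (0 : ℝ) T, ∀ x : M, φ ρ x ≠ x := by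
  obtain ⟨c, hc, H⟩ : ∃ c > 0, ∀ x ∈ (univ : Set M), ∃ t : ℝ, c < dist (φ t x) x := by
    refine isCompact_univ.induction_on (p := fun S => ∃ c > 0, ∀ x ∈ S, ∃ t : ℝ, c < dist (φ t x) x)
      ⟨1, one_pos, by simp⟩ ?_ ?_ ?_
    · rintro S S' hS ⟨c, hc, H⟩
      exact ⟨c, hc, fun x hx => H x (hS hx)⟩
    · rintro S S' ⟨c, hc, H⟩ ⟨c', hc', H'⟩
      refine ⟨min c c', lt_min hc hc', ?_⟩
      rintro x (hx | hx)
      · obtain ⟨t, ht⟩ := H x hx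
        exact ⟨t, (min_le_left _ _).trans_lt ht⟩
      · obtain ⟨t, ht⟩ := H' x hx
        exact ⟨t, (min_le_right _ _).trans_lt ht⟩
    · intro x _
      obtain ⟨t, ht⟩ := hfix x
      have hd := dist_pos.2 ht
      have hcont : Continuous fun y => dist (φ t y) y := (h.continuous_time t).dist continuous_id
      refine ⟨{y | dist (φ t x) x / 2 < dist (φ t y) y},
        mem_nhdsWithin_of_mem_nhds ((isOpen_lt continuous_const hcont).mem_nhds (half_lt_self hd)),
        dist (φ t x) x / 2, half_pos hd, fun y hy => ⟨t, hy⟩⟩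
  obtain ⟨T, hT, hmod⟩ := h.time_modulus hc
  refine ⟨T, hT, fun ρ hρ x hx => ?_⟩
  obtain ⟨t, ht⟩ := H x (mem_univ x)
  have h0 : 0 ≤ t - ⌊t / ρ⌋ * ρ := by
    have := (le_div_iff₀ hρ.1).1 (Int.floor_le (t / ρ)); linarith
  have h1 : t - ⌊t / ρ⌋ * ρ < ρ := by
    have := (div_lt_iff₀ hρ.1).1 (Int.lt_floor_add_one (t / ρ)); linarith
  have h2 : φ t x = φ (t - ⌊t / ρ⌋ * ρ) x := by
    conv_rhs => rw [← h.iterate_period hx ⌊t / ρ⌋]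
    rw [← h.add]; congr 1; ring
  have := hmod (t - ⌊t / ρ⌋ * ρ) (by rw [abs_of_nonneg h0]; exact h1.trans hρ.2) x
  rw [← h2] at this
  exact lt_asymm this ht

/-- A continuous time change along which one orbit follows another stays close to the identity. -/
lemma exists_drift_lt (h : IsContFlow φ) {ρ : ℝ} (hne : ∀ x : M, φ ρ x ≠ x) (hρ : 0 < ρ) (L : ℝ) :
    ∃ η > 0, ∀ (x y : M) (β : ℝ → ℝ), ContinuousOn β (Icc 0 L) → β 0 = 0 →
      (∀ s ∈ Icc (0 : ℝ) L, dist (φ (β s) x) (φ s y) < η) →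
      ∀ s ∈ Icc (0 : ℝ) L, |β s - s| < ρ := by
  obtain ⟨γ, hγ, Hγ⟩ := isCompact_univ.exists_forall_le' (s := (univ : Set M)) (a := (0 : ℝ))
    (f := fun x => dist (φ ρ x) x) ((h.continuous_time ρ).dist continuous_id).continuousOn
    (fun x _ => dist_pos.2 (hne x))
  obtain ⟨σ, hσ, Hσ⟩ := h.space_modulus L (half_pos hγ)
  refine ⟨min σ (γ / 2), by positivity, fun x y β hβ hβ0 hd s hs => ?_⟩
  have hxy : dist x y < σ := by
    have := hd 0 ⟨le_rfl, hs.1.trans hs.2⟩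
    rw [hβ0, h.zero, h.zero] at this
    exact this.trans_le (min_le_left _ _)
  have key : ∀ r ∈ Icc (0 : ℝ) L, |β r - r| ≠ ρ := by
    intro r hr hrρ
    have h1 : dist (φ (β r) x) (φ r x) < γ := by
      have h1 := (hd r hr).trans_le (min_le_right _ _)
      have h2 := Hσ x y hxy r hr
      rw [dist_comm (φ r x)] at h2
      linarith [dist_triangle (φ (β r) x) (φ r y) (φ r x)]
    rcases (abs_eq hρ.le).1 hrρ with h2 | h2
    · rw [show β r = ρ + r by linarith, h.add] at h1
      exact absurd (Hγ _ (mem_univ (φ r x))) (not_le.2 h1)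
    · rw [dist_comm, show r = ρ + β r by linarith, h.add,
        show ρ + β r = r by linarith] at h1
      exact absurd (Hγ _ (mem_univ (φ (β r) x))) (not_le.2 h1)
  by_contra! hcon
  have hcont : ContinuousOn (fun r => |β r - r|) (Icc 0 s) :=
    ((hβ.mono (Icc_subset_Icc_right hs.2)).sub continuousOn_id).abs
  obtain ⟨r, hr, hr'⟩ := intermediate_value_Icc hs.1 hcont
    (show ρ ∈ Icc _ _ by simp [hβ0, hρ.le, hcon])
  exact key r ⟨hr.1, hr.2.trans hs.2⟩ hr'

/-- Along a point of a small reparametrization ball, the reparametrization is sampled at the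
multiples of `L` by a sequence whose increments are close to `L`. -/
lemma exists_sampling (h : IsContFlow φ) {ρ : ℝ} (hne : ∀ x : M, φ ρ x ≠ x) (hρ : 0 < ρ)
    {L : ℝ} (hL : 0 < L) :
    ∃ η₀ > 0, ∀ η ≤ η₀, ∀ (x y : M) (t : ℝ), y ∈ RepBowenBall φ x t η →
      ∃ a : ℕ → ℝ, a 0 = 0 ∧
        (∀ k : ℕ, k * L ≤ t → dist (φ (a k) x) (φ (k * L) y) < η) ∧
        ∀ k : ℕ, (k + 1) * L ≤ t → |a (k + 1) - a k - L| < ρ := by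
  obtain ⟨η₀, hη₀, H⟩ := h.exists_drift_lt hne hρ L
  refine ⟨η₀, hη₀, ?_⟩
  rintro η hη x y t ⟨α, ⟨hαc, -, hα0⟩, hα⟩
  refine ⟨fun k => α (k * L), by simpa using hα0, fun k hk => hα _ ⟨by positivity, hk⟩,
    fun k hk => ?_⟩
  have hsub : ∀ s ∈ Icc (0 : ℝ) L, k * L + s ∈ Icc 0 t := fun s hs =>
    ⟨by have := hs.1; positivity, by linarith [hs.2]⟩
  have := H (φ (α (k * L)) x) (φ (k * L) y) (fun s => α (k * L + s) - α (k * L))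
    ((hαc.comp (by fun_prop) hsub).sub continuousOn_const) (by simp) (fun s hs => by
      rw [← h.add, ← h.add, sub_add_cancel, add_comm s]
      exact (hα _ (hsub s hs)).trans_le hη) L ⟨hL.le, le_rfl⟩
  convert this using 4
  push_cast; ring_nf

end IsContFlow

/-- Points with the same code represent each other, so a set is covered by as many balls as there
are codes. -/
lemma exists_representatives {M ι : Type*} [Fintype ι] (S : Set M) (c : M → ι) (B : M → Set M)
    (hB : ∀ y ∈ S, ∀ z ∈ S, c y = c z → z ∈ B y) :
    ∃ G : Finset M, ↑G ⊆ S ∧ G.card ≤ Fintype.card ι ∧ S ⊆ ⋃ y ∈ G, B y := by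
  classical
  have hr : ∀ i : c '' S, ∃ y ∈ S, c y = i := fun i => i.2
  choose r hrS hr using hr
  refine ⟨Finset.univ.image r, ?_, ?_, fun z hz => ?_⟩
  · simpa [range_subset_iff] using hrS
  · exact Finset.card_image_le.trans (Fintype.card_subtype_le _)
  · simp only [mem_iUnion]
    have hz' : c z ∈ c '' S := ⟨z, hz, rfl⟩
    exact ⟨r ⟨c z, hz'⟩, by simp, hB _ (hrS _) _ hz (hr _)⟩

lemma floor_sub_sub_mem (u v w : ℝ) (huv : |u - v - w| < 1) :
    ⌊u⌋ - ⌊v⌋ - ⌊w⌋ ∈ Finset.Icc (-1 : ℤ) 2 := by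
  obtain ⟨h1, h2⟩ := abs_lt.1 huv
  have := Int.floor_le u
  have := Int.floor_le v
  have := Int.floor_le w
  have := Int.lt_floor_add_one u
  have := Int.lt_floor_add_one v
  have := Int.lt_floor_add_one w
  rw [Finset.mem_Icc]
  constructor
  · have : (-2 : ℝ) < ((⌊u⌋ - ⌊v⌋ - ⌊w⌋ : ℤ) : ℝ) := by push_cast; linarith
    have : -2 < ⌊u⌋ - ⌊v⌋ - ⌊w⌋ := by exact_mod_cast this
    omega
  · have : ((⌊u⌋ - ⌊v⌋ - ⌊w⌋ : ℤ) : ℝ) < 3 := by push_cast; linarith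
    have : ⌊u⌋ - ⌊v⌋ - ⌊w⌋ < 3 := by exact_mod_cast this
    omega

lemma natFloor_div_mul_le {t L : ℝ} (hL : 0 < L) (ht : 0 ≤ t) {k : ℕ} (hk : k ≤ ⌊t / L⌋₊) :
    k * L ≤ t :=
  (le_div_iff₀ hL).1 ((Nat.le_floor_iff (by positivity)).1 hk)

lemma abs_integral_orbit_le {M : Type*} (φ : ℝ → M → M) {f : M → ℝ} {K : ℝ}
    (hK : ∀ x, |f x| ≤ K) (x : M) (a b : ℝ) : |∫ s in a..b, f (φ s x)| ≤ K * |b - a| := by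
  simpa using intervalIntegral.norm_integral_le_of_norm_le_const (f := fun s => f (φ s x))
    (a := a) (b := b) (C := K) (fun s _ => hK _)

lemma abs_sub_nat_mul_le {ρ L : ℝ} {a : ℕ → ℝ} (ha0 : a 0 = 0) {n : ℕ}
    (hstep : ∀ k < n, |a (k + 1) - a k - L| ≤ ρ) : |a n - n * L| ≤ n * ρ := by
  induction n with
  | zero => simp [ha0]
  | succ n ih =>
    have h1 := ih fun k hk => hstep k (hk.trans n.lt_succ_self)
    have h2 := hstep n n.lt_succ_self
    rw [abs_le] at *
    push_cast
    constructor <;> linarith [h1.1, h1.2, h2.1, h2.2]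

namespace IsContFlow

section Topology

variable {M : Type*} [TopologicalSpace M] {φ : ℝ → M → M}

lemma integral_sub_eq (h : IsContFlow φ) {f : M → ℝ} (hf : Continuous f) (x : M) (a b : ℝ) :
    (∫ s in (0 : ℝ)..b, f (φ s x)) - ∫ s in (0 : ℝ)..a, f (φ s x) = ∫ s in a..b, f (φ s x) :=
  intervalIntegral.integral_interval_sub_left (h.intervalIntegrable hf x 0 b)
    (h.intervalIntegrable hf x 0 a)

/-- Birkhoff integrals along an orbit which shadows another one up to a slow drift. -/
lemma abs_integral_sub_le_of_sampling (h : IsContFlow φ) {f : M → ℝ} (hf : Continuous f)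
    {K : ℝ} (hK : ∀ x, |f x| ≤ K) {ρ κ L : ℝ} (hL : 0 < L) {x y : M} {a : ℕ → ℝ} (ha0 : a 0 = 0)
    {n : ℕ} (hstep : ∀ k < n, |a (k + 1) - a k - L| ≤ ρ)
    (hclose : ∀ k < n, ∀ s ∈ Icc (0 : ℝ) L,
      |f (φ s (φ (k * L) y)) - f (φ s (φ (a k) x))| ≤ κ) :
    |(∫ s in (0 : ℝ)..(n * L), f (φ s y)) - ∫ s in (0 : ℝ)..(a n), f (φ s x)|
      ≤ n * (κ * L + K * ρ) := by
  induction n with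
  | zero => simp [ha0]
  | succ n ih =>
    have h1 := ih (fun k hk => hstep k (hk.trans n.lt_succ_self))
      (fun k hk => hclose k (hk.trans n.lt_succ_self))
    have hK0 : 0 ≤ K := (abs_nonneg _).trans (hK x)
    have h2 : |(∫ s in (0 : ℝ)..L, f (φ s (φ (n * L) y)))
        - ∫ s in (0 : ℝ)..L, f (φ s (φ (a n) x))| ≤ κ * L := by
      rw [← intervalIntegral.integral_sub (h.intervalIntegrable hf _ _ _)
        (h.intervalIntegrable hf _ _ _)]
      have := intervalIntegral.norm_integral_le_of_norm_le_const (a := 0) (b := L) (C := κ)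
        (f := fun s => f (φ s (φ (n * L) y)) - f (φ s (φ (a n) x))) (fun s hs => by
          rw [uIoc_of_le hL.le] at hs
          exact hclose n n.lt_succ_self s ⟨hs.1.le, hs.2⟩)
      simpa [abs_of_pos hL] using this
    rw [h.integral_shift, h.integral_shift] at h2
    have h3 := abs_integral_orbit_le φ hK x (a n + L) (a (n + 1))
    have h4 : K * |a (n + 1) - (a n + L)| ≤ K * ρ :=
      mul_le_mul_of_nonneg_left (by simpa [sub_sub] using hstep n n.lt_succ_self) hK0
    have e1 := h.integral_sub_eq hf y (n * L) (n * L + L)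
    have e2 := h.integral_sub_eq hf x (a n) (a n + L)
    have e3 := h.integral_sub_eq hf x (a n + L) (a (n + 1))
    push_cast
    rw [show ((n : ℝ) + 1) * L = n * L + L by ring]
    rw [abs_le] at *
    constructor <;> linarith [h1.1, h1.2, h2.1, h2.2, h3.1, h3.2]

end Topology

variable {M : Type*} [MetricSpace M] {φ : ℝ → M → M}

lemma mem_bowenBall_of_samples (h : IsContFlow φ) {L σ ε t : ℝ} (hL : 0 < L)
    (hσ : ∀ u v : M, dist u v < σ → ∀ s ∈ Icc (0 : ℝ) L, dist (φ s u) (φ s v) < ε) {y z : M}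
    (hyz : ∀ k ≤ ⌊t / L⌋₊, dist (φ (k * L) y) (φ (k * L) z) < σ) : z ∈ BowenBall φ y t ε := by
  intro s hs
  have h0 : 0 ≤ s / L := div_nonneg hs.1 hL.le
  have h1 := hσ _ _ (hyz ⌊s / L⌋₊ (Nat.floor_le_floor (by gcongr; exact hs.2)))
    (s - ⌊s / L⌋₊ * L) ⟨?_, ?_⟩
  · rwa [← h.add, ← h.add, sub_add_cancel] at h1
  · linarith [(le_div_iff₀ hL).1 (Nat.floor_le h0)]
  · have := (div_lt_iff₀ hL).1 (Nat.lt_floor_add_one (s / L)); linarith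

variable [CompactSpace M]

/-- The compact space `M` is covered by at most exponentially many Bowen balls. -/
lemma exists_cover_bowenBall (h : IsContFlow φ) {ε : ℝ} (hε : 0 < ε) :
    ∃ m : ℕ, ∀ t ≥ 0, ∃ F : Finset M, F.card ≤ m ^ (⌊t⌋₊ + 1) ∧
      (⋃ x ∈ F, BowenBall φ x t ε) = univ := by
  obtain ⟨σ, hσ, Hσ⟩ := h.space_modulus 1 hε
  obtain ⟨A, -, hA, hcov⟩ := (isCompact_univ (X := M)).finite_cover_balls (half_pos hσ)
  have := hA.fintype
  have hc : ∀ x : M, ∃ p : A, dist x p < σ / 2 := fun x => by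
    have := hcov (mem_univ x)
    simp only [mem_iUnion, Metric.mem_ball] at this
    obtain ⟨p, hp, hxp⟩ := this
    exact ⟨⟨p, hp⟩, hxp⟩
  choose c hc using hc
  refine ⟨Fintype.card A, fun t ht => ?_⟩
  obtain ⟨G, -, hG, hGcov⟩ := exists_representatives univ
    (fun x => fun k : Fin (⌊t⌋₊ + 1) => c (φ k x)) (fun x => BowenBall φ x t ε) (by
      intro y _ z _ hyz
      refine h.mem_bowenBall_of_samples one_pos Hσ fun k hk => ?_
      rw [div_one] at hk
      have e := congrFun hyz ⟨k, by omega⟩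
      have h1 := hc (φ (k * 1) y)
      have h2 := hc (φ (k * 1) z)
      simp only [mul_one] at *
      rw [← e, dist_comm] at h2
      linarith [dist_triangle (φ k y) (c (φ k y)) (φ k z)])
  exact ⟨G, by simpa using hG, univ_subset_iff.1 hGcov⟩

/-- Small reparametrization balls are covered by few Bowen balls centred at points with comparable
Birkhoff integrals. -/
lemma exists_cover_repBowenBall (h : IsContFlow φ) (hfix : ∀ x : M, ∃ t : ℝ, φ t x ≠ x)
    {f : M → ℝ} (hf : Continuous f) {ε κ : ℝ} (hε : 0 < ε) (hκ : 0 < κ) :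
    ∃ η₀ > 0, ∃ C : ℝ, ∀ η ≤ η₀, ∀ t ≥ 0, ∀ x : M, ∃ G : Finset M,
      (G.card : ℝ) ≤ Real.exp (κ * t) ∧ RepBowenBall φ x t η ⊆ ⋃ y ∈ G, BowenBall φ y t ε ∧
      ∀ y ∈ G, (∫ s in (0 : ℝ)..t, f (φ s y)) ≤ (∫ s in (0 : ℝ)..t, f (φ s x)) + κ * t + C := by
  obtain ⟨K, hK0, hK⟩ : ∃ K : ℝ, 0 ≤ K ∧ ∀ x, |f x| ≤ K := by
    obtain ⟨K, hK⟩ := isCompact_univ.exists_bound_of_continuousOn hf.continuousOn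
    exact ⟨max K 0, le_max_right _ _, fun x => (hK x (mem_univ x)).trans (le_max_left _ _)⟩
  obtain ⟨ε', hε', hfε'⟩ := Metric.uniformContinuous_iff.1
    (CompactSpace.uniformContinuous_of_continuous hf) (κ / 2) (half_pos hκ)
  obtain ⟨L, hL, hLκ⟩ : ∃ L > 0, Real.log 4 ≤ κ * L :=
    ⟨Real.log 4 / κ, div_pos (Real.log_pos (by norm_num)) hκ, by rw [mul_div_cancel₀ _ hκ.ne']⟩
  obtain ⟨σ, hσ, Hσ⟩ := h.space_modulus L (lt_min hε hε')
  obtain ⟨r, hr, Hr⟩ := h.time_modulus (half_pos hσ)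
  obtain ⟨T, hT, HT⟩ := h.exists_no_short_period hfix
  obtain ⟨ρ, hρ, hρr, hρT, hρK⟩ : ∃ ρ > 0, ρ < r ∧ ρ < T ∧ 2 * K * ρ ≤ κ * L / 2 := by
    have hq : 0 < κ * L / (4 * (K + 1)) := by positivity
    obtain ⟨ρ, hρ, hρ'⟩ := exists_between (lt_min hr (lt_min hT hq))
    simp only [lt_min_iff] at hρ'
    refine ⟨ρ, hρ, hρ'.1, hρ'.2.1, ?_⟩
    have := (lt_div_iff₀ (by positivity)).1 hρ'.2.2
    nlinarith
  obtain ⟨η₀, hη₀, Hη⟩ := h.exists_sampling (HT ρ ⟨hρ, hρT⟩) hρ hL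
  refine ⟨min η₀ (σ / 4), by positivity, 2 * K * L, fun η hη t ht x => ?_⟩
  have hη4 := hη.trans (min_le_right _ _)
  set n := ⌊t / L⌋₊ with hn
  have hnL : n * L ≤ t := natFloor_div_mul_le hL ht le_rfl
  have hnL' : t < n * L + L := by
    have := (div_lt_iff₀ hL).1 (Nat.lt_floor_add_one (t / L)); linarith
  have hsamp : ∀ y ∈ RepBowenBall φ x t η, ∃ a : ℕ → ℝ, a 0 = 0 ∧
      (∀ k ≤ n, dist (φ (a k) x) (φ (k * L) y) < η) ∧ ∀ k < n, |a (k + 1) - a k - L| < ρ := by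
    intro y hy
    obtain ⟨a, ha0, ha1, ha2⟩ := Hη η (hη.trans (min_le_left _ _)) x y t hy
    exact ⟨a, ha0, fun k hk => ha1 k (natFloor_div_mul_le hL ht hk), fun k hk => ha2 k (by
      exact_mod_cast natFloor_div_mul_le hL ht (k := k + 1) hk)⟩
  choose! a ha0 had hstep using hsamp
  have hmem : ∀ y ∈ RepBowenBall φ x t η, ∀ k < n,
      ⌊a y (k + 1) / ρ⌋ - ⌊a y k / ρ⌋ - ⌊L / ρ⌋ ∈ Finset.Icc (-1 : ℤ) 2 := fun y hy k hk => by
    refine floor_sub_sub_mem _ _ _ ?_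
    rw [← sub_div, ← sub_div, abs_div, abs_of_pos hρ, div_lt_one hρ]
    exact hstep y hy k hk
  classical
  obtain ⟨G, hGS, hG, hGcov⟩ := exists_representatives (RepBowenBall φ x t η)
    (fun y => fun k : Fin n =>
      if hy : y ∈ RepBowenBall φ x t η then (⟨_, hmem y hy k k.2⟩ : Finset.Icc (-1 : ℤ) 2)
      else ⟨0, by simp⟩) (fun y => BowenBall φ y t ε) (by
    intro y hy z hz hyz
    have hfl : ∀ k ≤ n, ⌊a y k / ρ⌋ = ⌊a z k / ρ⌋ := by
      intro k
      induction k with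
      | zero => simp [ha0 y hy, ha0 z hz]
      | succ k ih =>
        intro hk
        have e := congrFun hyz ⟨k, hk⟩
        simp only [hy, hz, dif_pos, Subtype.mk.injEq] at e
        have := ih (by omega)
        omega
    refine h.mem_bowenBall_of_samples hL
      (fun u v huv s hs => (Hσ u v huv s hs).trans_le (min_le_left _ _)) fun k hk => ?_
    have h1 := had y hy k hk
    have h2 := had z hz k hk
    have h3 : |a y k - a z k| < r := by
      have := Int.abs_sub_lt_one_of_floor_eq_floor (hfl k hk)
      rw [← sub_div, abs_div, abs_of_pos hρ, div_lt_one hρ] at this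
      exact this.trans hρr
    have h4 := Hr _ h3 (φ (a z k) x)
    rw [← h.add, sub_add_cancel] at h4
    rw [dist_comm] at h1
    linarith [dist_triangle4 (φ (k * L) y) (φ (a y k) x) (φ (a z k) x) (φ (k * L) z)])
  refine ⟨G, ?_, hGcov, fun y hy => ?_⟩
  · have h1 : (G.card : ℝ) ≤ 4 ^ n := by
      have : G.card ≤ 4 ^ n := by simpa using hG
      exact_mod_cast this
    refine h1.trans ?_
    rw [← Real.exp_log (show (0 : ℝ) < 4 by norm_num), ← Real.exp_nat_mul]
    refine Real.exp_le_exp.2 ?_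
    calc n * Real.log 4 ≤ n * (κ * L) := by gcongr
      _ = κ * (n * L) := by ring
      _ ≤ κ * t := by gcongr
  · have hy := hGS hy
    have h1 := h.abs_integral_sub_le_of_sampling hf hK (κ := κ / 2) hL (ha0 y hy)
      (fun k hk => (hstep y hy k hk).le) (fun k hk s hs => (hfε' ((Hσ _ _ (by
        rw [dist_comm]
        exact (had y hy k hk.le).trans_le (by linarith)) s hs).trans_le (min_le_right _ _))).le)
    have h2 := abs_sub_nat_mul_le (ha0 y hy) (fun k hk => (hstep y hy k hk).le)
    have h3 := abs_integral_orbit_le φ hK y (n * L) t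
    have h4 := abs_integral_orbit_le φ hK x (a y n) t
    have e1 := h.integral_sub_eq hf y (n * L) t
    have e2 := h.integral_sub_eq hf x (a y n) t
    have h5 : K * |t - n * L| ≤ K * L :=
      mul_le_mul_of_nonneg_left (abs_le.2 ⟨by linarith, by linarith⟩) hK0
    have h6 : K * |t - a y n| ≤ K * (n * ρ + L) :=
      mul_le_mul_of_nonneg_left (by rw [abs_le] at *; constructor <;> linarith [h2.1, h2.2]) hK0
    have h7 : (n : ℝ) * (κ / 2 * L + 2 * K * ρ) ≤ κ * t := by
      calc (n : ℝ) * (κ / 2 * L + 2 * K * ρ) ≤ n * (κ * L) := by gcongr; linarith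
        _ = κ * (n * L) := by ring
        _ ≤ κ * t := by gcongr
    have := (abs_le.1 h1).2
    have := (abs_le.1 h3).2
    have := (abs_le.1 h4).1
    linarith

end IsContFlow

lemma bowenBall_subset_repBowenBall {M : Type*} [MetricSpace M] (φ : ℝ → M → M) (x : M)
    (t ε : ℝ) : BowenBall φ x t ε ⊆ RepBowenBall φ x t ε :=
  fun _ hy => ⟨id, ⟨continuousOn_id, strictMono_id.strictMonoOn _, rfl⟩, hy⟩

lemma sum_biUnion_le_of_nonneg {α β : Type*} [DecidableEq β] {w : β → ℝ} (hw : ∀ y, 0 ≤ w y)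
    (F : Finset α) (G : α → Finset β) : ∑ y ∈ F.biUnion G, w y ≤ ∑ x ∈ F, ∑ y ∈ G x, w y := by
  classical
  induction F using Finset.induction_on with
  | empty => simp
  | insert x F hx ih =>
    rw [Finset.biUnion_insert, Finset.sum_insert hx]
    have h1 := Finset.sum_union_inter (s₁ := G x) (s₂ := F.biUnion G) (f := w)
    have h2 : 0 ≤ ∑ y ∈ G x ∩ F.biUnion G, w y := Finset.sum_nonneg fun y _ => hw y
    linarith

section NmuFlow

variable {M : Type*} [MeasurableSpace M] {φ : ℝ → M → M} {μ : Measure M}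
  {f : M → ℝ} {Bb Bb' : M → ℝ → ℝ → Set M} {K δ t ε : ℝ}

lemma exp_neg_le_fweight (hK : ∀ x, |f x| ≤ K) (ht : 0 ≤ t) {F : Finset M}
    (hF : ENNReal.ofReal (1 - δ) < μ (⋃ x ∈ F, Bb x t ε)) :
    Real.exp (-(K * t)) ≤ fweight φ f t F := by
  obtain ⟨x, hx⟩ : F.Nonempty := by
    by_contra! h
    simp [h] at hF
  have h1 := abs_integral_orbit_le φ hK x 0 t
  rw [sub_zero, abs_of_nonneg ht] at h1
  exact (Real.exp_le_exp.2 (abs_le.1 h1).1).trans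
    (Finset.single_le_sum (f := fun x => Real.exp (∫ s in (0 : ℝ)..t, f (φ s x)))
      (fun _ _ => (Real.exp_pos _).le) hx)

lemma nmuFlow_le_fweight {F : Finset M} (hF : ENNReal.ofReal (1 - δ) < μ (⋃ x ∈ F, Bb x t ε)) :
    NmuFlow φ μ Bb δ t ε f ≤ fweight φ f t F := by
  refine csInf_le ⟨0, ?_⟩ ⟨F, hF, rfl⟩
  rintro _ ⟨F, -, rfl⟩
  exact Finset.sum_nonneg fun _ _ => (Real.exp_pos _).le

lemma le_nmuFlow {c : ℝ} (hne : ∃ F : Finset M, ENNReal.ofReal (1 - δ) < μ (⋃ x ∈ F, Bb x t ε))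
    (hc : ∀ F : Finset M, ENNReal.ofReal (1 - δ) < μ (⋃ x ∈ F, Bb x t ε) → c ≤ fweight φ f t F) :
    c ≤ NmuFlow φ μ Bb δ t ε f := by
  obtain ⟨F, hF⟩ := hne
  refine le_csInf ⟨_, F, hF, rfl⟩ ?_
  rintro _ ⟨F, hF, rfl⟩
  exact hc F hF

lemma nmuFlow_anti (hsub : ∀ x, Bb x t ε ⊆ Bb' x t ε)
    (hne : ∃ F : Finset M, ENNReal.ofReal (1 - δ) < μ (⋃ x ∈ F, Bb x t ε)) :
    NmuFlow φ μ Bb' δ t ε f ≤ NmuFlow φ μ Bb δ t ε f :=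
  le_nmuFlow hne fun _ hF =>
    nmuFlow_le_fweight (hF.trans_le (measure_mono (iUnion₂_mono fun x _ => hsub x)))

/-- Comparison of the two quantities when each ball of one kind is covered by few balls of the
other kind. -/
lemma nmuFlow_le_exp_mul {ε' A B : ℝ}
    (hne : ∃ F : Finset M, ENNReal.ofReal (1 - δ) < μ (⋃ x ∈ F, Bb' x t ε'))
    (hcov : ∀ x : M, ∃ G : Finset M, (G.card : ℝ) ≤ Real.exp A ∧
      Bb' x t ε' ⊆ ⋃ y ∈ G, Bb y t ε ∧
      ∀ y ∈ G, (∫ s in (0 : ℝ)..t, f (φ s y)) ≤ (∫ s in (0 : ℝ)..t, f (φ s x)) + B) :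
    NmuFlow φ μ Bb δ t ε f ≤ Real.exp (A + B) * NmuFlow φ μ Bb' δ t ε' f := by
  classical
  rw [← div_le_iff₀' (Real.exp_pos _)]
  refine le_nmuFlow hne fun F hF => ?_
  rw [div_le_iff₀' (Real.exp_pos _)]
  choose G hcard hG hw using hcov
  have hF' : ENNReal.ofReal (1 - δ) < μ (⋃ y ∈ F.biUnion G, Bb y t ε) := by
    refine hF.trans_le (measure_mono ?_)
    rw [Finset.set_biUnion_biUnion]
    exact iUnion₂_mono fun x _ => hG x
  refine (nmuFlow_le_fweight hF').trans ?_
  rw [fweight, fweight, Finset.mul_sum]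
  have hnn : ∀ y : M, 0 ≤ Real.exp (∫ s in (0 : ℝ)..t, f (φ s y)) := fun y => (Real.exp_pos _).le
  calc ∑ y ∈ F.biUnion G, Real.exp (∫ s in (0 : ℝ)..t, f (φ s y))
      ≤ ∑ x ∈ F, ∑ y ∈ G x, Real.exp (∫ s in (0 : ℝ)..t, f (φ s y)) :=
        sum_biUnion_le_of_nonneg hnn F G
    _ ≤ ∑ x ∈ F, Real.exp (A + B) * Real.exp (∫ s in (0 : ℝ)..t, f (φ s x)) := by
        refine Finset.sum_le_sum fun x _ => ?_
        calc ∑ y ∈ G x, Real.exp (∫ s in (0 : ℝ)..t, f (φ s y))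
            ≤ (G x).card • Real.exp ((∫ s in (0 : ℝ)..t, f (φ s x)) + B) :=
              Finset.sum_le_card_nsmul _ _ _ fun y hy => Real.exp_le_exp.2 (hw x y hy)
          _ ≤ Real.exp A * Real.exp ((∫ s in (0 : ℝ)..t, f (φ s x)) + B) := by
              rw [nsmul_eq_mul]
              exact mul_le_mul_of_nonneg_right (hcard x) (Real.exp_pos _).le
          _ = Real.exp (A + B) * Real.exp (∫ s in (0 : ℝ)..t, f (φ s x)) := by
              rw [← Real.exp_add, ← Real.exp_add]; ring_nf

end NmuFlow

section Rate

variable {u v : ℝ → ℝ} {B κ : ℝ}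

lemma limsup_le_limsup_add (hu : ∀ᶠ t in atTop, |u t| ≤ B) (hv : ∀ᶠ t in atTop, |v t| ≤ B)
    (huv : ∀ᶠ t in atTop, u t ≤ v t + κ) : limsup u atTop ≤ limsup v atTop + κ := by
  have hu' : IsBoundedUnder (· ≥ ·) atTop u :=
    isBoundedUnder_of_eventually_ge (hu.mono fun _ h => (abs_le.1 h).1)
  have hv' : IsBoundedUnder (· ≥ ·) atTop v :=
    isBoundedUnder_of_eventually_ge (hv.mono fun _ h => (abs_le.1 h).1)
  have hv'' : IsBoundedUnder (· ≤ ·) atTop v :=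
    isBoundedUnder_of_eventually_le (hv.mono fun _ h => (abs_le.1 h).2)
  rw [← limsup_add_const _ _ _ hv'' hv'.isCoboundedUnder_le]
  exact limsup_le_limsup huv hu'.isCoboundedUnder_le
    ⟨B + κ, eventually_map.2 (hv.mono fun _ h => by linarith [(abs_le.1 h).2])⟩

lemma liminf_le_liminf_add (hu : ∀ᶠ t in atTop, |u t| ≤ B) (hv : ∀ᶠ t in atTop, |v t| ≤ B)
    (huv : ∀ᶠ t in atTop, u t ≤ v t + κ) : liminf u atTop ≤ liminf v atTop + κ := by
  have hu' : IsBoundedUnder (· ≥ ·) atTop u :=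
    isBoundedUnder_of_eventually_ge (hu.mono fun _ h => (abs_le.1 h).1)
  have hv' : IsBoundedUnder (· ≥ ·) atTop v :=
    isBoundedUnder_of_eventually_ge (hv.mono fun _ h => (abs_le.1 h).1)
  have hv'' : IsBoundedUnder (· ≤ ·) atTop v :=
    isBoundedUnder_of_eventually_le (hv.mono fun _ h => (abs_le.1 h).2)
  rw [← liminf_add_const _ _ _ hv''.isCoboundedUnder_ge hv']
  refine liminf_le_liminf huv hu' (IsBoundedUnder.isCoboundedUnder_ge
    ⟨B + κ, eventually_map.2 (hv.mono fun _ h => by linarith [(abs_le.1 h).2])⟩)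

/-- Two functions which are interlaced near `0⁺` have the same limit there, the value being the
same also when the limit does not exist. -/
lemma zlim_congr_of_interlaced {p q : ℝ → ℝ} (hqp : ∀ ε > 0, q ε ≤ p ε)
    (hpq : ∀ ε > 0, ∀ κ > 0, ∀ᶠ η in 𝓝[>] (0 : ℝ), p ε ≤ q η + κ) : zlim p = zlim q := by
  have hpos : ∀ᶠ ε in 𝓝[>] (0 : ℝ), 0 < ε := self_mem_nhdsWithin
  have key : ∀ l, Tendsto p (𝓝[>] 0) (𝓝 l) ↔ Tendsto q (𝓝[>] 0) (𝓝 l) := by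
    intro l
    constructor <;> intro hl
    · rw [tendsto_order] at hl ⊢
      refine ⟨fun a ha => ?_, fun a ha => ?_⟩
      · obtain ⟨b, hab, hbl⟩ := exists_between ha
        obtain ⟨ε, hε, hbε⟩ := (hpos.and (hl.1 b hbl)).exists
        filter_upwards [hpq ε hε (b - a) (by linarith)] with η hη
        linarith
      · filter_upwards [hl.2 a ha, hpos] with ε h hε
        exact (hqp ε hε).trans_lt h
    · refine tendsto_of_tendsto_of_tendsto_of_le_of_le' hl tendsto_const_nhds
        (hpos.mono hqp) (hpos.mono fun ε hε => le_of_forall_pos_le_add fun κ hκ => ?_)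
      exact ge_of_tendsto (hl.add_const κ) (hpq ε hε κ hκ)
  unfold zlim limUnder lim
  exact congrArg _ (funext fun l => propext (key l))

end Rate

section Pressure

variable {M : Type*} [MetricSpace M] [CompactSpace M] [MeasurableSpace M]
  {φ : ℝ → M → M} {μ : Measure M} [IsProbabilityMeasure μ] {f : M → ℝ} {δ : ℝ}

lemma IsContFlow.exists_admissible (h : IsContFlow φ) (hδ : 0 < δ) {ε t : ℝ} (hε : 0 < ε)
    (ht : 0 ≤ t) : ∃ F : Finset M, ENNReal.ofReal (1 - δ) < μ (⋃ x ∈ F, BowenBall φ x t ε) := by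
  obtain ⟨m, hm⟩ := h.exists_cover_bowenBall hε
  obtain ⟨F, -, hF⟩ := hm t ht
  refine ⟨F, ?_⟩
  rw [hF, measure_univ, ENNReal.ofReal_lt_one]
  linarith

/-- Bounds on the exponential growth rates, for Bowen balls and reparametrization balls at once. -/
lemma IsContFlow.exists_rate_bounds (h : IsContFlow φ) (hδ : 0 < δ) (hf : Continuous f) {ε : ℝ}
    (hε : 0 < ε) : ∃ B : ℝ, ∀ t ≥ 1,
      |Real.log (NmuFlow φ μ (BowenBall φ) δ t ε f) / t| ≤ B ∧
      |Real.log (NmuFlow φ μ (RepBowenBall φ) δ t ε f) / t| ≤ B ∧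
      0 < NmuFlow φ μ (RepBowenBall φ) δ t ε f ∧
      NmuFlow φ μ (RepBowenBall φ) δ t ε f ≤ NmuFlow φ μ (BowenBall φ) δ t ε f := by
  obtain ⟨K, hK⟩ := isCompact_univ.exists_bound_of_continuousOn hf.continuousOn
  replace hK : ∀ x, |f x| ≤ K := fun x => hK x (mem_univ x)
  obtain ⟨m, hm⟩ := h.exists_cover_bowenBall hε
  refine ⟨2 * Real.log m + K, fun t ht => ?_⟩
  have ht0 : 0 < t := by linarith
  have hne := h.exists_admissible (μ := μ) hδ hε ht0.le
  have hle : NmuFlow φ μ (RepBowenBall φ) δ t ε f ≤ NmuFlow φ μ (BowenBall φ) δ t ε f :=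
    nmuFlow_anti (fun x => bowenBall_subset_repBowenBall φ x t ε) hne
  have hlow : Real.exp (-(K * t)) ≤ NmuFlow φ μ (RepBowenBall φ) δ t ε f := by
    obtain ⟨F, hF⟩ := hne
    exact le_nmuFlow ⟨F, hF.trans_le
      (measure_mono (iUnion₂_mono fun x _ => bowenBall_subset_repBowenBall φ x t ε))⟩
      fun F hF => exp_neg_le_fweight hK ht0.le hF
  have hpos := (Real.exp_pos _).trans_le hlow
  have hup : NmuFlow φ μ (BowenBall φ) δ t ε f ≤ (m : ℝ) ^ (⌊t⌋₊ + 1) * Real.exp (K * t) := by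
    obtain ⟨F, hFc, hF⟩ := hm t ht0.le
    have hFad : ENNReal.ofReal (1 - δ) < μ (⋃ x ∈ F, BowenBall φ x t ε) := by
      rw [hF, measure_univ, ENNReal.ofReal_lt_one]; linarith
    refine (nmuFlow_le_fweight hFad).trans ((Finset.sum_le_card_nsmul _ _ (Real.exp (K * t))
      fun x _ => Real.exp_le_exp.2 ?_).trans ?_)
    · have := abs_integral_orbit_le φ hK x 0 t
      rw [sub_zero, abs_of_pos ht0] at this
      exact (abs_le.1 this).2
    · rw [nsmul_eq_mul]
      gcongr
      exact_mod_cast hFc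
  have hm0 : (0 : ℝ) < (m : ℝ) ^ (⌊t⌋₊ + 1) :=
    pos_of_mul_pos_left ((hpos.trans_le hle).trans_le hup) (Real.exp_pos _).le
  have hlog1 : -(K * t) ≤ Real.log (NmuFlow φ μ (RepBowenBall φ) δ t ε f) :=
    (Real.le_log_iff_exp_le hpos).2 hlow
  have hlog2 := Real.log_le_log hpos hle
  have hlog3 : Real.log (NmuFlow φ μ (BowenBall φ) δ t ε f) ≤ (2 * Real.log m + K) * t := by
    refine (Real.log_le_log (hpos.trans_le hle) hup).trans ?_
    rw [Real.log_mul hm0.ne' (Real.exp_pos _).ne', Real.log_exp, Real.log_pow]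
    have h1 : ((⌊t⌋₊ + 1 : ℕ) : ℝ) ≤ 2 * t := by
      push_cast; linarith [Nat.floor_le ht0.le]
    have := mul_le_mul_of_nonneg_right h1 (Real.log_natCast_nonneg m)
    linarith
  have hlogm : 0 ≤ Real.log m * t := mul_nonneg (Real.log_natCast_nonneg m) ht0.le
  refine ⟨?_, ?_, hpos, hle⟩ <;>
  · rw [abs_div, abs_of_pos ht0, div_le_iff₀ ht0, abs_le]
    constructor <;> linarith

/-- The growth rate at scale `ε` for Bowen balls is almost dominated by the growth rate for
reparametrization balls at every sufficiently small scale. -/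
lemma IsContFlow.eventually_rate_le (h : IsContFlow φ) (hfix : ∀ x : M, ∃ t : ℝ, φ t x ≠ x)
    (hδ : 0 < δ) (hf : Continuous f) {ε κ : ℝ} (hε : 0 < ε) (hκ : 0 < κ) :
    ∀ᶠ η in 𝓝[>] (0 : ℝ), ∀ᶠ t in atTop,
      Real.log (NmuFlow φ μ (BowenBall φ) δ t ε f) / t ≤
        Real.log (NmuFlow φ μ (RepBowenBall φ) δ t η f) / t + κ := by
  obtain ⟨η₀, hη₀, C, H⟩ := h.exists_cover_repBowenBall hfix hf hε (show 0 < κ / 3 by positivity)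
  filter_upwards [Ioc_mem_nhdsGT hη₀] with η hη
  obtain ⟨B, hB⟩ := h.exists_rate_bounds (μ := μ) hδ hf hε
  obtain ⟨B', hB'⟩ := h.exists_rate_bounds (μ := μ) hδ hf hη.1
  filter_upwards [eventually_ge_atTop 1, eventually_ge_atTop (C / (κ / 3))] with t ht htC
  have ht0 : 0 < t := by linarith
  have hC : C ≤ κ / 3 * t := (div_le_iff₀' (by positivity)).1 htC
  obtain ⟨-, -, hpos, hle⟩ := hB t ht
  obtain ⟨-, -, hpos', -⟩ := hB' t ht
  have hne : ∃ F : Finset M, ENNReal.ofReal (1 - δ) < μ (⋃ x ∈ F, RepBowenBall φ x t η) := by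
    obtain ⟨F, hF⟩ := h.exists_admissible (μ := μ) hδ hη.1 ht0.le
    exact ⟨F, hF.trans_le
      (measure_mono (iUnion₂_mono fun x _ => bowenBall_subset_repBowenBall φ x t η))⟩
  have key := nmuFlow_le_exp_mul (Bb := BowenBall φ) (ε := ε) (A := κ / 3 * t)
    (B := κ / 3 * t + C) (φ := φ) (f := f) hne fun x => by
      simpa only [add_assoc] using H η hη.2 t ht0.le x
  have := Real.log_le_log (hpos.trans_le hle) key
  rw [Real.log_mul (Real.exp_pos _).ne' hpos'.ne', Real.log_exp] at this
  rw [div_add' _ _ _ ht0.ne']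
  gcongr
  linarith

end Pressure

theorem metric_pressure_plain_eq_reparametrized
    {M : Type*} [MetricSpace M] [CompactSpace M]
    [MeasurableSpace M] [BorelSpace M]
    (φ : ℝ → M → M)
    (hφcont : Continuous fun p : ℝ × M => φ p.1 p.2)
    (hφ0 : ∀ x, φ 0 x = x)
    (hφadd : ∀ t s x, φ (t + s) x = φ t (φ s x))
    (hfix : ∀ x : M, ∃ t : ℝ, φ t x ≠ x)
    (μ : MeasureTheory.Measure M) [MeasureTheory.IsProbabilityMeasure μ]
    {δ : ℝ} (hδ : δ ∈ Ioo (0 : ℝ) 1) (f : M → ℝ) (hf : Continuous f) :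
    (zlim fun ε => upRate fun t => NmuFlow φ μ (BowenBall φ) δ t ε f) =
        (zlim fun ε => upRate fun t => NmuFlow φ μ (RepBowenBall φ) δ t ε f) ∧
      (zlim fun ε => loRate fun t => NmuFlow φ μ (BowenBall φ) δ t ε f) =
        (zlim fun ε => loRate fun t => NmuFlow φ μ (RepBowenBall φ) δ t ε f) := by
  have h : IsContFlow φ := ⟨hφcont, hφ0, hφadd⟩
  have hpos : ∀ᶠ η in 𝓝[>] (0 : ℝ), 0 < η := self_mem_nhdsWithin
  constructor <;>
  · refine zlim_congr_of_interlaced (fun ε hε => ?_) (fun ε hε κ hκ => ?_)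
    · obtain ⟨B, hB⟩ := h.exists_rate_bounds (μ := μ) hδ.1 hf hε
      have hle : ∀ᶠ t in atTop, Real.log (NmuFlow φ μ (RepBowenBall φ) δ t ε f) / t ≤
          Real.log (NmuFlow φ μ (BowenBall φ) δ t ε f) / t + 0 := by
        filter_upwards [eventually_ge_atTop 1] with t ht
        obtain ⟨-, -, hp, hle⟩ := hB t ht
        rw [add_zero]
        gcongr
      have hP := (eventually_ge_atTop 1).mono fun t ht => (hB t ht).1
      have hQ := (eventually_ge_atTop 1).mono fun t ht => (hB t ht).2.1
      first
      | exact (limsup_le_limsup_add hQ hP hle).trans_eq (add_zero _)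
      | exact (liminf_le_liminf_add hQ hP hle).trans_eq (add_zero _)
    · filter_upwards [hpos, h.eventually_rate_le (μ := μ) hfix hδ.1 hf hε hκ] with η hη hle
      obtain ⟨B, hB⟩ := h.exists_rate_bounds (μ := μ) hδ.1 hf hε
      obtain ⟨B', hB'⟩ := h.exists_rate_bounds (μ := μ) hδ.1 hf hη
      have hP := (eventually_ge_atTop 1).mono fun t ht =>
        (hB t ht).1.trans (le_max_left B B')
      have hQ := (eventually_ge_atTop 1).mono fun t ht =>
        (hB' t ht).2.1.trans (le_max_right B B')
      first
      | exact limsup_le_limsup_add hP hQ hle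
      | exact liminf_le_liminf_add hP hQ hle
end
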